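/- Let V : ℝⁿ → ℝⁿ be continuously differentiable, let u(x) = R/(βn) + (R² − ‖x‖²)/(2n), and let x ∈ ℝⁿ with ‖x‖ = R, with ν = x/R. Then the following boundary identity holds: ∂_ν(y ↦ V(y)·∇u(y))(x) + (∂u/∂ν(x))·div V(x) − ν·(D_V(x)·∇u(x)) − ∇u(x)·(D_V(x)·ν) + β·u(x)·(div V(x) − ν·(D_V(x)·ν)) + β·(V(x)·∇u(x)) = −((1 + βR)/n)·(V(x)·ν). (This is the boundary computation yielding the Robin condition ∂u′/∂ν + βu′ = ((1+βR)/n)(V·ν) satisfied by the shape derivative u′ of the torsion function on the ball.) -/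

import Mathlib

open MeasureTheory Metric
open scoped RealInnerProductSpace

/-- The divergence of a vector field `F : ℝⁿ → ℝⁿ` at `x`: the trace of its Jacobian,
computed as `∑ i ⟪D_F(x) eᵢ, eᵢ⟫` over the standard basis. -/
noncomputable def diverg {n : ℕ} (F : EuclideanSpace ℝ (Fin n) → EuclideanSpace ℝ (Fin n))
    (x : EuclideanSpace ℝ (Fin n)) : ℝ :=
  ∑ i : Fin n, ⟪fderiv ℝ F x (EuclideanSpace.single i 1), EuclideanSpace.single i 1⟫

/-- Boundary computation yielding the Robin condition satisfied by the shape derivative of the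
Robin torsion function on the ball: for `u(x) = R/(βn) + (R² − ‖x‖²)/(2n)`, a `C¹` vector field
`V`, and a boundary point `‖x‖ = R` with outer unit normal `ν = x/R`,
`∂_ν(V·∇u) + (∂u/∂ν) div V − ν·(D_V ∇u) − ∇u·(D_V ν) + βu (div V − ν·(D_V ν)) + β(V·∇u)
  = −((1 + βR)/n)(V·ν)`. -/
theorem shape_derivative_boundary_equation (n : ℕ) (hn : 2 ≤ n) (R β : ℝ) (hR : 0 < R)
    (hβ : 0 < β) (V : EuclideanSpace ℝ (Fin n) → EuclideanSpace ℝ (Fin n))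
    (hV : ContDiff ℝ 1 V) (u : EuclideanSpace ℝ (Fin n) → ℝ)
    (hu : ∀ x, u x = R / (β * n) + (R ^ 2 - ‖x‖ ^ 2) / (2 * n)) :
    ∀ x : EuclideanSpace ℝ (Fin n), ‖x‖ = R →
      fderiv ℝ (fun y => ⟪V y, gradient u y⟫) x ((1 / R) • x)
        + fderiv ℝ u x ((1 / R) • x) * diverg V x
        - ⟪(1 / R) • x, fderiv ℝ V x (gradient u x)⟫
        - ⟪gradient u x, fderiv ℝ V x ((1 / R) • x)⟫
        + β * u x * (diverg V x - ⟪(1 / R) • x, fderiv ℝ V x ((1 / R) • x)⟫)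
        + β * ⟪V x, gradient u x⟫
      = -((1 + β * R) / n) * ⟪V x, (1 / R) • x⟫ := by
  intro x hx
  have hn0 : (n : ℝ) ≠ 0 := by
    have : n ≠ 0 := by omega
    exact_mod_cast this
  have hgrad : ∀ y, HasGradientAt u ((-(1 / (n : ℝ))) • y) y := by
    intro y
    rw [hasGradientAt_iff_hasFDerivAt]
    have h1 : HasFDerivAt (fun z : EuclideanSpace ℝ (Fin n) => ‖z‖ ^ 2)
        (2 • (innerSL ℝ y)) y := (hasStrictFDerivAt_norm_sq y).hasFDerivAt
    have h2 := ((h1.const_sub (R ^ 2)).mul_const (1 / (2 * (n : ℝ)))).const_add (R / (β * n))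
    have hu' : u = fun z => R / (β * n) + (R ^ 2 - ‖z‖ ^ 2) * (1 / (2 * (n : ℝ))) := by
      funext z
      rw [hu z]
      ring
    rw [hu']
    refine h2.congr_fderiv ?_
    ext w
    simp [inner_smul_left]
    field_simp
  have hg : ∀ y, gradient u y = (-(1 / (n : ℝ))) • y := fun y => (hgrad y).gradient
  have hVd : HasFDerivAt V (fderiv ℝ V x) x :=
    (hV.differentiable (by norm_num) x).hasFDerivAt
  have hf1 : fderiv ℝ (fun y => ⟪V y, gradient u y⟫) x ((1 / R) • x)
      = ⟪V x, (-(1 / (n : ℝ))) • ((1 / R) • x)⟫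
        + ⟪fderiv ℝ V x ((1 / R) • x), (-(1 / (n : ℝ))) • x⟫ := by
    simp only [hg]
    have h := hVd.inner ℝ ((hasFDerivAt_id x).const_smul (-(1 / (n : ℝ))))
    have h' := h.fderiv
    simp only [id, Pi.smul_apply] at h'
    rw [h']
    simp [fderivInnerCLM_apply, inner_smul_left, inner_smul_right]
    ring
  have hf2 : fderiv ℝ u x ((1 / R) • x) = -(R / n) := by
    rw [(hasGradientAt_iff_hasFDerivAt.mp (hgrad x)).fderiv]
    simp only [InnerProductSpace.toDual_apply_apply, inner_smul_left, inner_smul_right,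
      real_inner_self_eq_norm_sq, hx]
    simp
    field_simp
  have hux : β * u x = R / n := by
    rw [hu x, hx]
    field_simp
    ring
  rw [hf1, hf2, hux, hg x]
  simp only [map_smul, inner_smul_left, inner_smul_right,
    real_inner_comm (fderiv ℝ V x x) x]
  simp
  field_simp
  ring
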